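/- Fix finite alphabets and a distortion measure d : 𝒳 × X̂ → [0,∞) such that for every x there is x̂ with d(x,x̂) = 0; let d_min = min{d(x,x̂) : d(x,x̂) > 0}. For any joint pmf Q_{XW} on 𝒳 × 𝒲 and any 0 ≤ D < D', the conditional rate-distortion function satisfies R_{X|W}(Q_{XW}, D) ≤ R_{X|W}(Q_{XW}, D') + (4(D'−D)/d_min)·log₂(|𝒳|·|𝒲|·|X̂|·d_min / (2(D'−D))), provided 2(D'−D)/d_min ≤ 1/2. -/

import Mathlib

open Finset

/-- Conditional mutual information `I(X; X̂ | W)` (in bits) of a joint pmf `Q` on `𝒳 × 𝒲`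
and a test channel `V : 𝒳 × 𝒲 → X̂`. -/
noncomputable def condMutualInfo {𝒳 𝒲 Xh : Type*} [Fintype 𝒳] [Fintype 𝒲] [Fintype Xh]
    (Q : 𝒳 × 𝒲 → ℝ) (V : 𝒳 × 𝒲 → Xh → ℝ) : ℝ :=
  ∑ x, ∑ w, ∑ xh, Q (x, w) * V (x, w) xh *
    Real.logb 2 (V (x, w) xh /
      (∑ x', (Q (x', w) / ∑ x'', Q (x'', w)) * V (x', w) xh))

/-- Conditional rate-distortion function `R_{X|W}(Q, D)`: the infimum of `I(X;X̂|W)` over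
channels with expected distortion at most `D`. -/
noncomputable def condRD {𝒳 𝒲 Xh : Type*} [Fintype 𝒳] [Fintype 𝒲] [Fintype Xh]
    (Q : 𝒳 × 𝒲 → ℝ) (d : 𝒳 × Xh → ℝ) (D : ℝ) : ℝ :=
  sInf { r : ℝ | ∃ V : 𝒳 × 𝒲 → Xh → ℝ,
    (∀ p xh, 0 ≤ V p xh) ∧ (∀ p, ∑ xh, V p xh = 1) ∧
    (∑ x, ∑ w, ∑ xh, Q (x, w) * V (x, w) xh * d (x, xh)) ≤ D ∧
    r = condMutualInfo Q V }

open Real in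
/-- The modulus of continuity of `x ↦ -x log x` on `[0, 1]` at small scales is `-t log t`. -/
lemma negMulLog_sub_le {a b : ℝ} (ha : 0 ≤ a) (hb : 0 ≤ b) (hb1 : b ≤ 1) (hab : |a - b| ≤ 1 / 4) :
    negMulLog a - negMulLog b ≤ negMulLog |a - b| := by
  rcases le_total b a with h | h
  · rw [abs_of_nonneg (sub_nonneg.2 h)]
    rcases hb.eq_or_lt with rfl | hb
    · simp
    rcases h.eq_or_lt with rfl | h
    · simp
    have h₁ : log b ≤ log a := log_le_log hb h.le
    have h₂ : log (a - b) ≤ log a := log_le_log (by linarith) (by linarith)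
    simp only [negMulLog]
    nlinarith [mul_nonneg hb.le (sub_nonneg.2 h₁), mul_nonneg (sub_pos.2 h).le (sub_nonneg.2 h₂)]
  · rw [abs_sub_comm, abs_of_nonneg (sub_nonneg.2 h)] at *
    rcases h.eq_or_lt with rfl | h
    · simp
    have hlog4 : 1 ≤ log 4 := by
      rw [le_log_iff_exp_le (by norm_num)]
      linarith [exp_one_lt_d9]
    have h₁ : log (b - a) ≤ log (1 / 4) := log_le_log (by linarith) hab
    have h₂ : negMulLog a - negMulLog b ≤ b - a := by
      have hb' : 0 < b := by linarith
      have hlb : log b ≤ 0 := log_nonpos hb hb1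
      rcases ha.eq_or_lt with rfl | ha
      · simp only [negMulLog]
        nlinarith
      have h₃ : log (b / a) ≤ b / a - 1 := log_le_sub_one_of_pos (by positivity)
      rw [log_div hb'.ne' ha.ne'] at h₃
      have h₄ : a * (log b - log a) ≤ a * (b / a - 1) := mul_le_mul_of_nonneg_left h₃ ha.le
      have h₅ : a * (b / a - 1) = b - a := by field_simp
      simp only [negMulLog]
      nlinarith
    rw [one_div, log_inv] at h₁
    refine h₂.trans ?_
    simp only [negMulLog]
    nlinarith

open Real in
/-- A nonnegative vector of total mass at most `τ` with at most `N` entries has entropy at most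
`τ log (N / τ)`, as soon as `τ ≤ N / e`. -/
lemma sum_negMulLog_le {ι : Type*} [Fintype ι] {t : ι → ℝ} {τ N : ℝ} (ht : ∀ i, 0 ≤ t i)
    (hτ : 0 < τ) (hsum : ∑ i, t i ≤ τ) (hN : Fintype.card ι ≤ N) (hN0 : 0 < N)
    (hlog : 1 ≤ log (N / τ)) :
    ∑ i, negMulLog (t i) ≤ τ * log (N / τ) := by
  have key : ∀ i, negMulLog (t i) ≤ t i * (log (N / τ) - 1) + τ / N := by
    intro i
    rcases (ht i).eq_or_lt with h | h
    · simp only [← h, negMulLog_zero, zero_mul, zero_add]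
      positivity
    have h₁ := log_le_sub_one_of_pos (x := τ / N / t i) (by positivity)
    rw [log_div (by positivity) h.ne', ← inv_div N τ, log_inv, inv_div] at h₁
    have h₂ := mul_le_mul_of_nonneg_left h₁ h.le
    have h₃ : t i * (τ / N / t i - 1) = τ / N - t i := by field_simp
    simp only [negMulLog]
    nlinarith
  have hcard : Fintype.card ι * (τ / N) ≤ τ := by
    calc Fintype.card ι * (τ / N) ≤ N * (τ / N) := by gcongr
      _ = τ := by field_simp
  calc ∑ i, negMulLog (t i) ≤ ∑ i, (t i * (log (N / τ) - 1) + τ / N) := sum_le_sum fun i _ => key i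
    _ = (∑ i, t i) * (log (N / τ) - 1) + Fintype.card ι * (τ / N) := by
      simp [sum_add_distrib, sum_mul]
    _ ≤ τ * (log (N / τ) - 1) + τ := by gcongr
    _ = τ * log (N / τ) := by ring

lemma abs_apply_le_half_of_sum_eq_zero {ι : Type*} [Fintype ι] {u : ι → ℝ} (hu : ∑ i, u i = 0)
    (i : ι) : |u i| ≤ (∑ j, |u j|) / 2 := by
  classical
  have h₁ := add_sum_erase univ u (mem_univ i)
  have h₂ := add_sum_erase univ (fun j => |u j|) (mem_univ i)
  have h₃ := abs_sum_le_sum_abs u (univ.erase i)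
  have h₄ : |u i| = |∑ j ∈ univ.erase i, u j| := by
    rw [← abs_neg]
    congr 1
    linarith
  linarith

open Real in
/-- Uniform continuity of the Shannon entropy in total variation. -/
lemma entropy_sub_le {ι : Type*} [Fintype ι] {p q : ι → ℝ} {τ N : ℝ} (hp : ∀ i, 0 ≤ p i)
    (hq : ∀ i, 0 ≤ q i) (hp1 : ∑ i, p i = 1) (hq1 : ∑ i, q i = 1) (hτ : 0 < τ) (hτ2 : τ ≤ 1 / 2)
    (hpq : ∑ i, |p i - q i| ≤ τ) (hN : Fintype.card ι ≤ N) (hN0 : 0 < N)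
    (hlog : 1 ≤ log (N / τ)) :
    ∑ i, negMulLog (p i) - ∑ i, negMulLog (q i) ≤ τ * log (N / τ) := by
  rw [← sum_sub_distrib]
  refine (sum_le_sum fun i _ => negMulLog_sub_le (hp i) (hq i) ?_ ?_).trans
    (sum_negMulLog_le (fun i => abs_nonneg _) hτ hpq hN hN0 hlog)
  · exact hq1 ▸ single_le_sum (fun j _ => hq j) (mem_univ i)
  · have := abs_apply_le_half_of_sum_eq_zero (u := fun i => p i - q i) (by simp [hp1, hq1]) i
    linarith

open Real in
/-- `I(X; X̂ | W) = H(X̂, W) - H(X, W, X̂) + H(X, W) - H(W)`. -/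
lemma condMutualInfo_eq {𝒳 𝒲 Xh : Type*} [Fintype 𝒳] [Fintype 𝒲] [Fintype Xh]
    {Q : 𝒳 × 𝒲 → ℝ} {V : 𝒳 × 𝒲 → Xh → ℝ} (h0 : ∀ p, 0 ≤ Q p) (hV0 : ∀ p a, 0 ≤ V p a)
    (hV1 : ∀ p, ∑ a, V p a = 1) :
    condMutualInfo Q V * log 2 =
      ∑ wa : 𝒲 × Xh, negMulLog (∑ x, Q (x, wa.1) * V (x, wa.1) wa.2)
      - ∑ xwa : (𝒳 × 𝒲) × Xh, negMulLog (Q xwa.1 * V xwa.1 xwa.2)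
      + ∑ p : 𝒳 × 𝒲, Q p * (log (∑ x, Q (x, p.2)) - log (Q p)) := by
  have hterm : ∀ x w a, Q (x, w) * V (x, w) a * logb 2 (V (x, w) a /
      (∑ x', (Q (x', w) / ∑ x'', Q (x'', w)) * V (x', w) a)) * log 2 =
      - (Q (x, w) * V (x, w) a * log (∑ x', Q (x', w) * V (x', w) a))
      - negMulLog (Q (x, w) * V (x, w) a)
      + Q (x, w) * V (x, w) a * (log (∑ x', Q (x', w)) - log (Q (x, w))) := by
    intro x w a
    rcases (h0 (x, w)).eq_or_lt with hQ | hQ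
    · simp [← hQ]
    rcases (hV0 (x, w) a).eq_or_lt with hV | hV
    · simp [← hV]
    have hW : 0 < ∑ x', Q (x', w) :=
      hQ.trans_le (single_le_sum (f := fun x' => Q (x', w)) (fun _ _ => h0 _) (mem_univ x))
    have hG : 0 < ∑ x', Q (x', w) * V (x', w) a :=
      (mul_pos hQ hV).trans_le (single_le_sum (f := fun x' => Q (x', w) * V (x', w) a)
        (fun _ _ => mul_nonneg (h0 _) (hV0 _ _)) (mem_univ x))
    have hM : ∑ x', (Q (x', w) / ∑ x'', Q (x'', w)) * V (x', w) a =
        (∑ x', Q (x', w) * V (x', w) a) / ∑ x', Q (x', w) := by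
      rw [sum_div]
      exact sum_congr rfl fun _ _ => by ring
    have hlog2 : log 2 ≠ 0 := (log_pos (by norm_num)).ne'
    rw [hM, mul_assoc, logb, div_mul_cancel₀ _ hlog2, log_div hV.ne' (by positivity),
      log_div hG.ne' hW.ne', negMulLog, log_mul hQ.ne' hV.ne']
    ring
  simp only [condMutualInfo, sum_mul, hterm, sum_add_distrib, sum_sub_distrib]
  have hC : ∀ x w, ∑ a, Q (x, w) * V (x, w) a * (log (∑ x', Q (x', w)) - log (Q (x, w))) =
      Q (x, w) * (log (∑ x', Q (x', w)) - log (Q (x, w))) := by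
    intro x w
    rw [← sum_mul, ← mul_sum, hV1, mul_one]
  simp only [hC, Fintype.sum_prod_type, negMulLog, sum_mul, neg_mul, sum_neg_distrib]
  congr 3
  rw [sum_comm]
  exact sum_congr rfl fun w _ => sum_comm

/-- Conditional mutual information is bounded below over all test channels. -/
lemma exists_le_condMutualInfo {𝒳 𝒲 Xh : Type*} [Fintype 𝒳] [Fintype 𝒲] [Fintype Xh]
    {Q : 𝒳 × 𝒲 → ℝ} (h0 : ∀ p, 0 ≤ Q p) (h1 : ∑ p, Q p = 1) :
    ∃ c, ∀ V : 𝒳 × 𝒲 → Xh → ℝ, (∀ p a, 0 ≤ V p a) → (∀ p, ∑ a, V p a = 1) →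
      c ≤ condMutualInfo Q V := by
  have hlog2 : 0 < Real.log 2 := Real.log_pos (by norm_num)
  refine ⟨(-Fintype.card ((𝒳 × 𝒲) × Xh) +
    ∑ p : 𝒳 × 𝒲, Q p * (Real.log (∑ x, Q (x, p.2)) - Real.log (Q p))) / Real.log 2,
    fun V hV0 hV1 => ?_⟩
  rw [div_le_iff₀ hlog2, condMutualInfo_eq h0 hV0 hV1]
  have hJ0 : ∀ p a, 0 ≤ Q p * V p a := fun p a => mul_nonneg (h0 p) (hV0 p a)
  have hG : 0 ≤ ∑ wa : 𝒲 × Xh, Real.negMulLog (∑ x, Q (x, wa.1) * V (x, wa.1) wa.2) := by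
    refine sum_nonneg fun wa _ => Real.negMulLog_nonneg (sum_nonneg fun x _ => hJ0 _ _) ?_
    calc ∑ x, Q (x, wa.1) * V (x, wa.1) wa.2 ≤ ∑ x, Q (x, wa.1) :=
          sum_le_sum fun x _ => mul_le_of_le_one_right (h0 _)
            (hV1 (x, wa.1) ▸ single_le_sum (fun a _ => hV0 _ a) (mem_univ wa.2))
      _ ≤ ∑ x, ∑ w, Q (x, w) := sum_le_sum fun x _ =>
          single_le_sum (f := fun w => Q (x, w)) (fun w _ => h0 _) (mem_univ wa.1)
      _ = 1 := by rw [← h1, Fintype.sum_prod_type]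
  have hJ : ∑ xwa : (𝒳 × 𝒲) × Xh, Real.negMulLog (Q xwa.1 * V xwa.1 xwa.2) ≤
      Fintype.card ((𝒳 × 𝒲) × Xh) := by
    calc _ ≤ ∑ _xwa : (𝒳 × 𝒲) × Xh, (1 : ℝ) := sum_le_sum fun xwa _ =>
          (Real.negMulLog_le_one_sub_self (hJ0 _ _)).trans (by linarith [hJ0 xwa.1 xwa.2])
      _ = _ := by simp
  linarith

/-- Moving a small amount of mass from outcomes of positive distortion to outcomes of zero
distortion lowers the distortion level to `D`. -/
lemma exists_channel_distortion_le {𝒳 𝒲 Xh : Type*} [Fintype 𝒳] [Fintype 𝒲] [Fintype Xh]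
    {Q : 𝒳 × 𝒲 → ℝ} (h0 : ∀ p, 0 ≤ Q p) {d : 𝒳 × Xh → ℝ} (hd0 : ∀ q, 0 ≤ d q)
    (hzero : ∀ x, ∃ xh, d (x, xh) = 0) {dmin : ℝ} (hdmin0 : 0 < dmin)
    (hdmin : ∀ q, 0 < d q → dmin ≤ d q) {D D' : ℝ} (hD0 : 0 ≤ D) (hDD' : D ≤ D')
    {V : 𝒳 × 𝒲 → Xh → ℝ} (hV0 : ∀ p a, 0 ≤ V p a) (hV1 : ∀ p, ∑ a, V p a = 1)
    (hV : ∑ x, ∑ w, ∑ a, Q (x, w) * V (x, w) a * d (x, a) ≤ D') :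
    ∃ V' : 𝒳 × 𝒲 → Xh → ℝ, (∀ p a, 0 ≤ V' p a) ∧ (∀ p, ∑ a, V' p a = 1) ∧
      ∑ x, ∑ w, ∑ a, Q (x, w) * V' (x, w) a * d (x, a) ≤ D ∧
      ∑ p, ∑ a, |Q p * V' p a - Q p * V p a| ≤ 2 * (D' - D) / dmin := by
  classical
  set E := ∑ x, ∑ w, ∑ a, Q (x, w) * V (x, w) a * d (x, a) with hE
  obtain ⟨l, hl0, hl1, hlD, hlE⟩ :
      ∃ l : ℝ, 0 ≤ l ∧ l ≤ 1 ∧ (1 - l) * E ≤ D ∧ l * E ≤ D' - D := by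
    rcases le_or_gt E D with h | h
    · exact ⟨0, le_rfl, zero_le_one, by linarith, by linarith⟩
    · have hE0 : 0 < E := hD0.trans_lt h
      refine ⟨(E - D) / E, div_nonneg (by linarith) hE0.le, ?_, ?_, ?_⟩
      · rw [div_le_one hE0]; linarith
      · apply le_of_eq; field_simp; ring
      · rw [div_mul_cancel₀ _ hE0.ne']; linarith
  choose f hf using hzero
  let B : 𝒳 × 𝒲 → Xh → ℝ := fun p a => if d (p.1, a) = 0 then 0 else V p a
  have hB0 : ∀ p a, 0 ≤ B p a := fun p a => by
    simp only [B]; split_ifs; exacts [le_rfl, hV0 p a]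
  have hBV : ∀ p a, B p a ≤ V p a := fun p a => by
    simp only [B]; split_ifs; exacts [hV0 p a, le_rfl]
  have hBd : ∀ p a, B p a * d (p.1, a) = V p a * d (p.1, a) := fun p a => by
    simp only [B]; split_ifs with h
    · simp [h]
    · rfl
  have hBdmin : ∀ p a, B p a * dmin ≤ V p a * d (p.1, a) := fun p a => by
    simp only [B]; split_ifs with h
    · simp [h]
    · exact mul_le_mul_of_nonneg_left (hdmin _ ((hd0 _).lt_of_ne' h)) (hV0 p a)
  refine ⟨fun p a => V p a - l * B p a + if a = f p.1 then l * ∑ b, B p b else 0,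
    fun p a => ?_, fun p => ?_, ?_, ?_⟩
  · have h₁ : l * B p a ≤ V p a := (mul_le_of_le_one_left (hB0 p a) hl1).trans (hBV p a)
    have h₂ : 0 ≤ if a = f p.1 then l * ∑ b, B p b else 0 := by
      split_ifs
      exacts [mul_nonneg hl0 (sum_nonneg fun b _ => hB0 p b), le_rfl]
    simp only
    linarith
  · simp [sum_add_distrib, hV1, ← mul_sum]
  · refine le_trans (le_of_eq ?_) hlD
    simp only [hE, mul_sum]
    refine sum_congr rfl fun x _ => sum_congr rfl fun w _ => sum_congr rfl fun a _ => ?_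
    have h₁ := hBd (x, w) a
    have h₂ : (if a = f x then ∑ b, l * B (x, w) b else 0) * d (x, a) = 0 := by
      split_ifs with h
      · rw [h, hf, mul_zero]
      · rw [zero_mul]
    simp only at h₁
    linear_combination -(l * Q (x, w)) * h₁ + Q (x, w) * h₂
  · have hpt : ∀ p, ∑ a, |Q p * (V p a - l * B p a + if a = f p.1 then l * ∑ b, B p b else 0)
        - Q p * V p a| ≤ 2 * l * ∑ a, Q p * B p a := by
      intro p
      calc _ ≤ ∑ a, (Q p * (l * B p a) + Q p * if a = f p.1 then l * ∑ b, B p b else 0) := by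
            refine sum_le_sum fun a _ => ?_
            have h₂ : 0 ≤ Q p * if a = f p.1 then l * ∑ b, B p b else 0 := by
              refine mul_nonneg (h0 p) ?_
              split_ifs
              exacts [mul_nonneg hl0 (sum_nonneg fun b _ => hB0 p b), le_rfl]
            have h₃ := mul_nonneg (h0 p) (mul_nonneg hl0 (hB0 p a))
            rw [abs_le]
            constructor <;> nlinarith
        _ = 2 * l * ∑ a, Q p * B p a := by
            simp only [sum_add_distrib, ← mul_sum, sum_ite_eq', mem_univ, if_true]
            ring
    refine (sum_le_sum fun p _ => hpt p).trans ?_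
    rw [← mul_sum, le_div_iff₀ hdmin0]
    have hmass : (∑ p, ∑ a, Q p * B p a) * dmin ≤ E := by
      rw [hE, Fintype.sum_prod_type]
      simp only [sum_mul]
      refine sum_le_sum fun x _ => sum_le_sum fun w _ => sum_le_sum fun a _ => ?_
      rw [mul_assoc, mul_assoc]
      exact mul_le_mul_of_nonneg_left (hBdmin (x, w) a) (h0 _)
    nlinarith [mul_le_mul_of_nonneg_left hmass hl0]

/-- Conditional mutual information is uniformly continuous in the joint law of
`(X, W, X̂)`, for a fixed law of `(X, W)`. -/
lemma condMutualInfo_le_add {𝒳 𝒲 Xh : Type*} [Fintype 𝒳] [Fintype 𝒲] [Fintype Xh]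
    [Nonempty 𝒳] {Q : 𝒳 × 𝒲 → ℝ} (h0 : ∀ p, 0 ≤ Q p) (h1 : ∑ p, Q p = 1)
    {V V' : 𝒳 × 𝒲 → Xh → ℝ} (hV0 : ∀ p a, 0 ≤ V p a) (hV1 : ∀ p, ∑ a, V p a = 1)
    (hV0' : ∀ p a, 0 ≤ V' p a) (hV1' : ∀ p, ∑ a, V' p a = 1) {τ N : ℝ} (hτ : 0 < τ)
    (hτ2 : τ ≤ 1 / 2) (hdist : ∑ p, ∑ a, |Q p * V' p a - Q p * V p a| ≤ τ)
    (hN : (Fintype.card 𝒳 : ℝ) * Fintype.card 𝒲 * Fintype.card Xh = N) (hN2 : 2 ≤ N) :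
    condMutualInfo Q V' ≤ condMutualInfo Q V + 2 * τ * Real.logb 2 (N / τ) := by
  have hN0 : 0 < N := by linarith
  have hlog2 : 0 < Real.log 2 := Real.log_pos (by norm_num)
  have hlog : 1 ≤ Real.log (N / τ) := by
    rw [Real.le_log_iff_exp_le (by positivity), le_div_iff₀ hτ]
    nlinarith [Real.exp_one_lt_d9, Real.exp_pos 1]
  have hJ0 : ∀ {U : 𝒳 × 𝒲 → Xh → ℝ}, (∀ p a, 0 ≤ U p a) → ∀ p a, 0 ≤ Q p * U p a :=
    fun hU p a => mul_nonneg (h0 p) (hU p a)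
  have hJ1 : ∀ {U : 𝒳 × 𝒲 → Xh → ℝ}, (∀ p, ∑ a, U p a = 1) →
      ∑ xwa : (𝒳 × 𝒲) × Xh, Q xwa.1 * U xwa.1 xwa.2 = 1 := by
    intro U hU
    rw [Fintype.sum_prod_type]
    simp only [← mul_sum, hU, mul_one, h1]
  have hG1 : ∀ {U : 𝒳 × 𝒲 → Xh → ℝ}, (∀ p, ∑ a, U p a = 1) →
      ∑ wa : 𝒲 × Xh, ∑ x, Q (x, wa.1) * U (x, wa.1) wa.2 = 1 := by
    intro U hU
    rw [← hJ1 hU, sum_comm, Fintype.sum_prod_type (α₁ := 𝒳 × 𝒲), Fintype.sum_prod_type]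
    exact sum_congr rfl fun x _ => Fintype.sum_prod_type _
  have hHJ : ∑ xwa : (𝒳 × 𝒲) × Xh, Real.negMulLog (Q xwa.1 * V xwa.1 xwa.2) -
      ∑ xwa : (𝒳 × 𝒲) × Xh, Real.negMulLog (Q xwa.1 * V' xwa.1 xwa.2) ≤
      τ * Real.log (N / τ) := by
    refine entropy_sub_le (fun _ => hJ0 hV0 _ _) (fun _ => hJ0 hV0' _ _) (hJ1 hV1) (hJ1 hV1')
      hτ hτ2 ?_ ?_ hN0 hlog
    · rw [Fintype.sum_prod_type]
      simpa only [abs_sub_comm] using hdist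
    · rw [← hN]
      simp
  have hHG : ∑ wa : 𝒲 × Xh, Real.negMulLog (∑ x, Q (x, wa.1) * V' (x, wa.1) wa.2) -
      ∑ wa : 𝒲 × Xh, Real.negMulLog (∑ x, Q (x, wa.1) * V (x, wa.1) wa.2) ≤
      τ * Real.log (N / τ) := by
    refine entropy_sub_le (fun _ => sum_nonneg fun _ _ => hJ0 hV0' _ _)
      (fun _ => sum_nonneg fun _ _ => hJ0 hV0 _ _) (hG1 hV1') (hG1 hV1) hτ hτ2 ?_ ?_ hN0 hlog
    · refine le_trans ?_ hdist
      calc _ ≤ ∑ wa : 𝒲 × Xh, ∑ x, |Q (x, wa.1) * V' (x, wa.1) wa.2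
              - Q (x, wa.1) * V (x, wa.1) wa.2| := by
            refine sum_le_sum fun wa _ => ?_
            rw [← sum_sub_distrib]
            exact abs_sum_le_sum_abs _ _
        _ = _ := by
            rw [sum_comm, Fintype.sum_prod_type]
            exact sum_congr rfl fun x _ => Fintype.sum_prod_type _
    · have : (1 : ℝ) ≤ Fintype.card 𝒳 := by exact_mod_cast Fintype.card_pos
      rw [← hN, Fintype.card_prod, Nat.cast_mul, mul_assoc]
      exact le_mul_of_one_le_left (by positivity) this
  have hI := condMutualInfo_eq h0 hV0 hV1
  have hI' := condMutualInfo_eq h0 hV0' hV1'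
  rw [← mul_le_mul_iff_left₀ hlog2, add_mul, hI, hI', Real.logb, mul_assoc,
    div_mul_cancel₀ _ hlog2.ne']
  linarith

/-- Uniform continuity of the conditional rate-distortion function in the distortion level
(Lemma continuityD): for `0 ≤ D < D'` with `2(D'−D)/d_min ≤ 1/2`,
`R_{X|W}(Q,D) ≤ R_{X|W}(Q,D') + (4(D'−D)/d_min)·log₂(|𝒳||𝒲||X̂|·d_min/(2(D'−D)))`. -/
theorem condRD_continuity_in_D
    {𝒳 𝒲 Xh : Type*} [Fintype 𝒳] [Fintype 𝒲] [Fintype Xh] [Nonempty 𝒳] [Nonempty 𝒲] [Nonempty Xh]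
    (Q : 𝒳 × 𝒲 → ℝ) (h0 : ∀ p, 0 ≤ Q p) (h1 : ∑ p, Q p = 1)
    (d : 𝒳 × Xh → ℝ) (hd0 : ∀ q, 0 ≤ d q)
    (hzero : ∀ x, ∃ xh, d (x, xh) = 0)
    (dmin : ℝ) (hdmin : IsLeast { r : ℝ | 0 < r ∧ ∃ q, d q = r } dmin)
    (D D' : ℝ) (hD0 : 0 ≤ D) (hDD' : D < D')
    (hsmall : 2 * (D' - D) / dmin ≤ 1 / 2) :
    condRD Q d D ≤ condRD Q d D' +
      (4 * (D' - D) / dmin) *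
        Real.logb 2 ((Fintype.card 𝒳 : ℝ) * (Fintype.card 𝒲 : ℝ) * (Fintype.card Xh : ℝ) *
          dmin / (2 * (D' - D))) := by
  classical
  obtain ⟨⟨hdmin0, ⟨x₀, a₀⟩, hq₀⟩, hle⟩ := hdmin
  have hcard : 2 ≤ Fintype.card Xh := by
    obtain ⟨b, hb⟩ := hzero x₀
    refine Fintype.one_lt_card_iff.2 ⟨a₀, b, ?_⟩
    rintro rfl
    linarith
  have hN2 : (2 : ℝ) ≤ (Fintype.card 𝒳 : ℝ) * Fintype.card 𝒲 * Fintype.card Xh := by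
    have h𝒳 : 0 < Fintype.card 𝒳 := Fintype.card_pos
    have h𝒲 : 0 < Fintype.card 𝒲 := Fintype.card_pos
    exact_mod_cast hcard.trans (Nat.le_mul_of_pos_left _ (Nat.mul_pos h𝒳 h𝒲))
  have hτ : 0 < 2 * (D' - D) / dmin := div_pos (by linarith) hdmin0
  have hK : (4 * (D' - D) / dmin) * Real.logb 2 ((Fintype.card 𝒳 : ℝ) * (Fintype.card 𝒲 : ℝ) *
      (Fintype.card Xh : ℝ) * dmin / (2 * (D' - D))) = 2 * (2 * (D' - D) / dmin) *
      Real.logb 2 ((Fintype.card 𝒳 : ℝ) * Fintype.card 𝒲 * Fintype.card Xh /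
        (2 * (D' - D) / dmin)) := by
    rw [div_div_eq_mul_div]
    ring
  rw [hK, ← sub_le_iff_le_add]
  refine le_csInf ?_ ?_
  · choose f hf using hzero
    refine ⟨_, fun p a => if a = f p.1 then 1 else 0, fun p a => ?_, fun p => by simp, ?_, rfl⟩
    · dsimp only
      split_ifs <;> norm_num
    · simp only [mul_ite, mul_one, mul_zero, ite_mul, zero_mul, sum_ite_eq', mem_univ, if_true,
        hf, sum_const_zero]
      linarith
  · rintro _ ⟨V, hV0, hV1, hV, rfl⟩
    obtain ⟨V', hV0', hV1', hV', hdist⟩ := exists_channel_distortion_le h0 hd0 hzero hdmin0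
      (fun q hq => hle ⟨hq, q, rfl⟩) hD0 hDD'.le hV0 hV1 hV
    obtain ⟨c, hc⟩ := exists_le_condMutualInfo (Xh := Xh) h0 h1
    rw [sub_le_iff_le_add]
    refine le_trans (b := condMutualInfo Q V') (csInf_le ⟨c, ?_⟩ ⟨V', hV0', hV1', hV', rfl⟩)
      (condMutualInfo_le_add h0 h1 hV0 hV1 hV0' hV1' hτ hsmall hdist rfl hN2)
    rintro _ ⟨U, hU0, hU1, -, rfl⟩
    exact hc U hU0 hU1
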